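/- If x̃ ∈ D minimizes x ↦ f(x) + ⟨λ, A x⟩ over D, i.e. f(x̃) + ⟨λ, A x̃⟩ ≤ f(x) + ⟨λ, A x⟩ for all x ∈ D, then f**(x̃) = f(x̃) and x̃ minimizes x ↦ f**(x) + ⟨λ, A x⟩ over convexHull(D), i.e. f**(x̃) + ⟨λ, A x̃⟩ ≤ f**(x) + ⟨λ, A x⟩ for all x ∈ convexHull(D). -/

import Mathlib

open scoped RealInnerProductSpace
open Finset

/-- Fenchel conjugate of `f` restricted to the set `Dset`. -/
noncomputable def fConj {n : ℕ} (Dset : Set (EuclideanSpace ℝ (Fin n)))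
    (f : EuclideanSpace ℝ (Fin n) → ℝ) (y : EuclideanSpace ℝ (Fin n)) : ℝ :=
  sSup ((fun x => ⟪y, x⟫ - f x) '' Dset)

/-- Biconjugate of `f` (with domain `Dset`). -/
noncomputable def fBiconj {n : ℕ} (Dset : Set (EuclideanSpace ℝ (Fin n)))
    (f : EuclideanSpace ℝ (Fin n) → ℝ) (x : EuclideanSpace ℝ (Fin n)) : ℝ :=
  sSup (Set.range fun y : EuclideanSpace ℝ (Fin n) => ⟪y, x⟫ - fConj Dset f y)

/-- The supremum defining the conjugate is over a set that is bounded above. -/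
theorem bddAbove_inner_sub_image {n : ℕ} {D : Set (EuclideanSpace ℝ (Fin n))}
    (hD : IsCompact D) {f : EuclideanSpace ℝ (Fin n) → ℝ} {c : ℝ} (hf : ∀ x ∈ D, |f x| ≤ c)
    (y : EuclideanSpace ℝ (Fin n)) : BddAbove ((fun x => ⟪y, x⟫ - f x) '' D) := by
  have hcont : Continuous fun x : EuclideanSpace ℝ (Fin n) => ⟪y, x⟫ := by fun_prop
  obtain ⟨b, hb⟩ := hD.bddAbove_image hcont.continuousOn
  refine ⟨b + c, ?_⟩
  rintro _ ⟨x, hx, rfl⟩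
  have h₁ : ⟪y, x⟫ ≤ b := hb ⟨x, hx, rfl⟩
  have h₂ := (abs_le.mp (hf x hx)).1
  dsimp only
  linarith

/-- Fenchel–Young inequality. -/
theorem inner_sub_fConj_le {n : ℕ} {D : Set (EuclideanSpace ℝ (Fin n))}
    (hD : IsCompact D) {f : EuclideanSpace ℝ (Fin n) → ℝ} {c : ℝ} (hf : ∀ x ∈ D, |f x| ≤ c)
    {x : EuclideanSpace ℝ (Fin n)} (hx : x ∈ D) (y : EuclideanSpace ℝ (Fin n)) :
    ⟪y, x⟫ - fConj D f y ≤ f x := by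
  have h : ⟪y, x⟫ - f x ≤ fConj D f y :=
    le_csSup (bddAbove_inner_sub_image hD hf y) ⟨x, hx, rfl⟩
  linarith

/-- The biconjugate is at most `f` on the domain. -/
theorem fBiconj_le {n : ℕ} {D : Set (EuclideanSpace ℝ (Fin n))}
    (hD : IsCompact D) {f : EuclideanSpace ℝ (Fin n) → ℝ} {c : ℝ} (hf : ∀ x ∈ D, |f x| ≤ c)
    {x : EuclideanSpace ℝ (Fin n)} (hx : x ∈ D) : fBiconj D f x ≤ f x := by
  refine csSup_le (Set.range_nonempty _) ?_
  rintro _ ⟨y, rfl⟩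
  exact inner_sub_fConj_le hD hf hx y

/-- On the convex hull of the domain, the biconjugate dominates each of its affine minorants. -/
theorem inner_sub_fConj_le_fBiconj {n : ℕ} {D : Set (EuclideanSpace ℝ (Fin n))}
    (hD : IsCompact D) {f : EuclideanSpace ℝ (Fin n) → ℝ} {c : ℝ} (hf : ∀ x ∈ D, |f x| ≤ c)
    {x : EuclideanSpace ℝ (Fin n)} (hx : x ∈ convexHull ℝ D) (y : EuclideanSpace ℝ (Fin n)) :
    ⟪y, x⟫ - fConj D f y ≤ fBiconj D f x := by
  refine le_csSup ⟨c, ?_⟩ ⟨y, rfl⟩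
  rintro _ ⟨z, rfl⟩
  have hsub : D ⊆ {w | innerₛₗ ℝ z w ≤ c + fConj D f z} := by
    intro w hw
    have h₁ := inner_sub_fConj_le hD hf hw z
    have h₂ := (abs_le.mp (hf w hw)).2
    simp only [Set.mem_ofPred_eq, innerₛₗ_apply_apply]
    linarith
  have h := convexHull_min hsub (convex_halfSpace_le (innerₛₗ ℝ z).isLinear _) hx
  simp only [Set.mem_ofPred_eq, innerₛₗ_apply_apply] at h
  dsimp only
  linarith

/-- a minimizer of `f + ⟨λ, A·⟩` over `D` has matching biconjugate value
and minimizes `f** + ⟨λ, A·⟩` over the convex hull of `D`. -/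
theorem oracle_minimizer_biconjugate
    (n m : ℕ) (Dset : Set (EuclideanSpace ℝ (Fin n)))
    (hDne : Dset.Nonempty) (hDcpt : IsCompact Dset)
    (f : EuclideanSpace ℝ (Fin n) → ℝ)
    (hflsc : LowerSemicontinuousOn f Dset)
    (hfbdd : ∃ c : ℝ, ∀ x ∈ Dset, |f x| ≤ c)
    (A : EuclideanSpace ℝ (Fin n) →ₗ[ℝ] EuclideanSpace ℝ (Fin m))
    (lam : EuclideanSpace ℝ (Fin m))
    (xt : EuclideanSpace ℝ (Fin n)) (hxt : xt ∈ Dset)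
    (hmin : ∀ x ∈ Dset, f xt + ⟪lam, A xt⟫ ≤ f x + ⟪lam, A x⟫) :
    fBiconj Dset f xt = f xt ∧
      ∀ x ∈ convexHull ℝ Dset,
        fBiconj Dset f xt + ⟪lam, A xt⟫ ≤ fBiconj Dset f x + ⟪lam, A x⟫ := by
  obtain ⟨c, hc⟩ := hfbdd
  have hinner : ∀ x, ⟪-(LinearMap.adjoint A lam), x⟫ = -⟪lam, A x⟫ := fun x => by
    rw [inner_neg_left, LinearMap.adjoint_inner_left]
  have hconj : fConj Dset f (-(LinearMap.adjoint A lam)) ≤ -(f xt + ⟪lam, A xt⟫) := by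
    refine csSup_le (hDne.image _) ?_
    rintro _ ⟨x, hx, rfl⟩
    have h := hmin x hx
    dsimp only
    rw [hinner]
    linarith
  have hlower : ∀ x ∈ convexHull ℝ Dset,
      f xt + ⟪lam, A xt⟫ ≤ fBiconj Dset f x + ⟪lam, A x⟫ := fun x hx => by
    have h := inner_sub_fConj_le_fBiconj hDcpt hc hx (-(LinearMap.adjoint A lam))
    rw [hinner] at h
    linarith
  have heq : fBiconj Dset f xt = f xt :=
    le_antisymm (fBiconj_le hDcpt hc hxt)
      (by linarith [hlower xt (subset_convexHull ℝ Dset hxt)])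
  exact ⟨heq, fun x hx => heq ▸ hlower x hx⟩
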